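/- The only positive rational numbers c for which d = c(2388 + 955c + 70c²) / (2(748 − 55c + c²)) is a positive integer are c = 1/2, 8, 52/5, 16, 132/7, 20, 102/5, 748/35, 43/2, 22, 808/35, 47/2, 24, 170/7, 49/2, 172/7, 152/5, 61/2, 154/5, 220/7, 63/2, 32, 164/5, 236/7, 34, 242/7, 36, 40, 204/5, 44, 109/2, 428/7, 68, 484/7, 187/2, 132, 1496. -/

import Mathlib

/-- The listed solutions as (numerator, denominator). -/
def solPairs : List (ℕ × ℕ) :=
  [(1, 2), (8, 1), (52, 5), (16, 1), (132, 7), (20, 1), (102, 5), (748, 35), (43, 2), (22, 1), (808, 35), (47, 2), (24, 1), (170, 7), (49, 2), (172, 7), (152, 5), (61, 2), (154, 5), (220, 7), (63, 2), (32, 1), (164, 5), (236, 7), (34, 1), (242, 7), (36, 1), (40, 1), (204, 5), (44, 1), (109, 2), (428, 7), (68, 1), (484, 7), (187, 2), (132, 1), (1496, 1)]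

/-- Newton iteration with fuel (no correctness claim is needed: results are checked). -/
def newtonIter (t : ℕ) : ℕ → ℕ → ℕ
  | 0, r => r
  | k + 1, r =>
    let r2 := (r + t / r) / 2
    bif Nat.ble r r2 then r else newtonIter t k r2

def rootApprox (t : ℕ) : ℕ := newtonIter t 12 (2 ^ (Nat.log2 t / 2 + 1))

def okPair (p q n : ℕ) : Bool :=
  Nat.beq p 0 || !(Nat.beq ((p * (70 * p * p + 955 * p * q + 2388 * q * q)) % (2 * q * n)) 0) ||
    solPairs.any (fun x => Nat.beq (p * x.2) (x.1 * q))

def checkRoot (t r q n : ℕ) : Bool :=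
  Nat.ble (r * r) t && Nat.ble (t + 1) ((r + 1) * (r + 1)) &&
    (!(Nat.beq (r * r) t) || (okPair ((55 * q + r) / 2) q n && okPair ((55 * q - r) / 2) q n))

def checkOne (q n : ℕ) : Bool :=
  checkRoot (33 * q * q + 4 * n) (rootApprox (33 * q * q + 4 * n)) q n

def listQ : List ℕ := [1, 2, 5, 7, 10, 14, 35, 70]
def listA : List ℕ := [1, 2, 4, 8, 16, 32, 64, 128, 256]
def listB : List ℕ := [1, 31, 961]
def listC : List ℕ :=
  [1, 3, 11, 17, 33, 37, 51, 111, 187, 407, 561, 629, 1221, 1887, 6919, 20757]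

def checkAll : Bool :=
  listQ.all fun q => listA.all fun a => listB.all fun b => listC.all fun e =>
    checkOne q (a * b * e)

theorem checkAll_true : checkAll = true := by decide +kernel

theorem mem_listQ (q : ℕ) (h : q ∣ 70) : q ∈ listQ := by
  have h1 : q ∈ Nat.divisors 70 := Nat.mem_divisors.2 ⟨h, by norm_num⟩
  have h2 : ∀ x ∈ Nat.divisors 70, x ∈ listQ := by decide +kernel
  exact h2 q h1

theorem mem_listA (q : ℕ) (h : q ∣ 256) : q ∈ listA := by
  have h1 : q ∈ Nat.divisors 256 := Nat.mem_divisors.2 ⟨h, by norm_num⟩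
  have h2 : ∀ x ∈ Nat.divisors 256, x ∈ listA := by decide +kernel
  exact h2 q h1

theorem mem_listB (q : ℕ) (h : q ∣ 961) : q ∈ listB := by
  have h1 : q ∈ Nat.divisors 961 := Nat.mem_divisors.2 ⟨h, by norm_num⟩
  have h2 : ∀ x ∈ Nat.divisors 961, x ∈ listB := by decide +kernel
  exact h2 q h1

theorem mem_listC (q : ℕ) (h : q ∣ 20757) : q ∈ listC := by
  have h0 : (20757 : ℕ) = 51 * 407 := by norm_num
  rw [h0] at h
  obtain ⟨u, v, hu, hv, rfl⟩ := exists_dvd_and_dvd_of_dvd_mul h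
  have h1 : u ∈ Nat.divisors 51 := Nat.mem_divisors.2 ⟨hu, by norm_num⟩
  have h2 : v ∈ Nat.divisors 407 := Nat.mem_divisors.2 ⟨hv, by norm_num⟩
  have h3 : ∀ x ∈ Nat.divisors 51, ∀ y ∈ Nat.divisors 407, x * y ∈ listC := by decide +kernel
  exact h3 u h1 v h2

theorem checkOne_of_dvd (q n : ℕ) (hq : q ∣ 70) (hn : n ∣ 256 * 961 * 20757) :
    checkOne q n = true := by
  obtain ⟨m, e, hm, he, rfl⟩ := exists_dvd_and_dvd_of_dvd_mul hn
  obtain ⟨a, b, ha, hb, rfl⟩ := exists_dvd_and_dvd_of_dvd_mul hm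
  have h := checkAll_true
  simp only [checkAll, List.all_eq_true] at h
  exact h q (mem_listQ q hq) a (mem_listA a ha) b (mem_listB b hb) e (mem_listC e he)

theorem okPair_spec (p q n d : ℕ) (hp0 : 0 < p) (hok : okPair p q n = true)
    (h : d * (2 * q * n) = p * (70 * p * p + 955 * p * q + 2388 * q * q)) :
    ∃ x ∈ solPairs, p * x.2 = x.1 * q := by
  rw [okPair, ← h, Nat.mul_mod_left] at hok
  have hp1 : Nat.beq p 0 = false := by
    cases p with
    | zero => omega
    | succ k => rfl
  simp only [hp1, Nat.beq_refl, Bool.not_true, Bool.false_or, List.any_eq_true] at hok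
  obtain ⟨x, hx, hx2⟩ := hok
  exact ⟨x, hx, Nat.eq_of_beq_eq_true hx2⟩

theorem checkOne_spec (p q n d : ℕ) (hp0 : 0 < p) (hc : checkOne q n = true)
    (hN : p * p + 748 * q * q = n + 55 * p * q)
    (h : d * (2 * q * n) = p * (70 * p * p + 955 * p * q + 2388 * q * q)) :
    ∃ x ∈ solPairs, p * x.2 = x.1 * q := by
  rw [checkOne] at hc
  generalize rootApprox (33 * q * q + 4 * n) = r at hc
  simp only [checkRoot, Bool.and_eq_true, Bool.or_eq_true, Nat.ble_eq] at hc
  obtain ⟨⟨h1, h2⟩, h3⟩ := hc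
  rcases le_total (55 * q) (2 * p) with hle | hle
  · obtain ⟨s, hs⟩ := Nat.exists_eq_add_of_le hle
    have hsq : s * s = 33 * q * q + 4 * n := by
      zify at *
      have : (s : ℤ) = 2 * p - 55 * q := by linarith
      rw [this]; linarith
    have hr : r = s := by
      apply le_antisymm
      · rw [← hsq] at h1
        exact Nat.mul_self_le_mul_self_iff.1 h1
      · rw [← hsq] at h2
        exact Nat.lt_succ_iff.1 (Nat.mul_self_lt_mul_self_iff.1 h2)
    subst hr
    rw [← hsq] at h3
    simp only [Nat.beq_refl, Bool.not_true, Bool.false_eq_true, false_or] at h3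
    have hp : (55 * q + r) / 2 = p := by omega
    rw [hp] at h3
    exact okPair_spec p q n d hp0 h3.1 h
  · obtain ⟨s, hs⟩ := Nat.exists_eq_add_of_le hle
    have hsq : s * s = 33 * q * q + 4 * n := by
      zify at *
      have : (s : ℤ) = 55 * q - 2 * p := by linarith
      rw [this]; linarith
    have hr : r = s := by
      apply le_antisymm
      · rw [← hsq] at h1
        exact Nat.mul_self_le_mul_self_iff.1 h1
      · rw [← hsq] at h2
        exact Nat.lt_succ_iff.1 (Nat.mul_self_lt_mul_self_iff.1 h2)
    subst hr
    rw [← hsq] at h3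
    simp only [Nat.beq_refl, Bool.not_true, Bool.false_eq_true, false_or] at h3
    have hp : (55 * q - r) / 2 = p := by omega
    rw [hp] at h3
    exact okPair_spec p q n d hp0 h3.2 h

theorem arith_core (p q d : ℤ) (hp : 0 < p) (hq : 0 < q) (hd : 0 < d) (hcop : IsCoprime p q)
    (h : d * (2 * q * (p * p - 55 * p * q + 748 * q * q)) =
      p * (70 * p * p + 955 * p * q + 2388 * q * q)) :
    ∃ x ∈ solPairs, p * (x.2 : ℤ) = x.1 * q := by
  have hG : 0 < p * (70 * p * p + 955 * p * q + 2388 * q * q) := by positivity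
  obtain ⟨N, hN⟩ : ∃ N, N = p * p - 55 * p * q + 748 * q * q := ⟨_, rfl⟩
  rw [← hN] at h
  have hNpos : 0 < N := by
    by_contra hh
    push Not at hh
    have h1 : 0 < d * (2 * q) := by positivity
    nlinarith
  have hq70 : q ∣ 70 := by
    have h1 : q ∣ p ^ 3 * 70 :=
      ⟨d * (2 * N) - p * (955 * p + 2388 * q), by linear_combination -h⟩
    exact (hcop.symm.pow_right).dvd_of_dvd_mul_left h1
  have hNq : IsCoprime N q := by
    have h1 : IsCoprime (p * p + q * (-55 * p + 748 * q)) q :=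
      (IsCoprime.add_mul_left_left_iff).2 (hcop.mul_left hcop)
    have h2 : N = p * p + q * (-55 * p + 748 * q) := by rw [hN]; ring
    rw [h2]; exact h1
  have hNK : N ∣ 256 * 961 * 20757 := by
    have h1 : N ∣ q * (961 * (p * (5 * p - 52 * q))) :=
      ⟨d * (2 * q) - 70 * p, by linear_combination (-1 : ℤ) * h + 70 * p * hN⟩
    have h2 := hNq.dvd_of_dvd_mul_left h1
    obtain ⟨k, hk⟩ := h2
    have h3 : N ∣ q ^ 4 * (256 * 961 * 20757) :=
      ⟨961 * 7104 * q ^ 2 + 961 * p * (55 * q - p) * 25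
          - k * (55 * q - p) * (5 * p - 223 * q), by
        have e1 : 748 * q ^ 2 = N + p * (55 * q - p) := by rw [hN]; ring
        have e2 : 7104 * q ^ 2 = 25 * N - (5 * p - 52 * q) * (5 * p - 223 * q) := by
          rw [hN]; ring
        linear_combination 961 * 7104 * q ^ 2 * e1 + 961 * p * (55 * q - p) * e2
          - (55 * q - p) * (5 * p - 223 * q) * hk⟩
    exact (hNq.pow_right).dvd_of_dvd_mul_left h3
  lift p to ℕ using hp.le
  lift q to ℕ using hq.le
  lift d to ℕ using hd.le
  lift N to ℕ using hNpos.le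
  have hq' : q ∣ 70 := by exact_mod_cast hq70
  have hN' : N ∣ 256 * 961 * 20757 := by exact_mod_cast hNK
  have e1 : p * p + 748 * q * q = N + 55 * p * q := by
    zify; rw [hN]; ring
  obtain ⟨x, hx, hx2⟩ :=
    checkOne_spec p q N d (by exact_mod_cast hp) (checkOne_of_dvd q N hq' hN') e1 (by exact_mod_cast h)
  exact ⟨x, hx, by exact_mod_cast hx2⟩

/-- The only positive rational numbers `c` for which
`d = c(2388 + 955c + 70c²) / (2(748 − 55c + c²))` is a positive integer are the
37 listed values. -/
theorem stmt_0 (c : ℚ) (hc : 0 < c) :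
    (748 - 55 * c + c ^ 2 ≠ 0 ∧
      ∃ d : ℤ, 0 < d ∧
        (d : ℚ) = c * (2388 + 955 * c + 70 * c ^ 2) / (2 * (748 - 55 * c + c ^ 2)))
    ↔ c ∈ ({1/2, 8, 52/5, 16, 132/7, 20, 102/5, 748/35, 43/2, 22, 808/35, 47/2, 24,
        170/7, 49/2, 172/7, 152/5, 61/2, 154/5, 220/7, 63/2, 32, 164/5, 236/7, 34,
        242/7, 36, 40, 204/5, 44, 109/2, 428/7, 68, 484/7, 187/2, 132, 1496} : Set ℚ) := by
  constructor
  · rintro ⟨hne, d, hd, hdc⟩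
    have hqz : (0 : ℚ) < c.den := by exact_mod_cast c.den_pos
    have hcc : c = (c.num : ℚ) / c.den := (Rat.num_div_den c).symm
    have hcop : IsCoprime c.num (c.den : ℤ) := by
      rw [Int.isCoprime_iff_gcd_eq_one]
      exact c.reduced
    have hcq : c * c.den = c.num := Rat.mul_den_eq_num c
    rw [eq_div_iff (mul_ne_zero two_ne_zero hne)] at hdc
    have key : (d : ℚ) * (2 * c.den * (c.num * c.num - 55 * c.num * c.den + 748 * c.den * c.den)) =
        c.num * (70 * c.num * c.num + 955 * c.num * c.den + 2388 * c.den * c.den) := by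
      rw [← hcq]
      linear_combination (c.den : ℚ) ^ 3 * hdc
    obtain ⟨x, hx, hx2⟩ := arith_core c.num c.den d (Rat.num_pos.2 hc)
      (by exact_mod_cast c.den_pos) hd hcop (by exact_mod_cast key)
    have hx3 : (c.num : ℚ) * x.2 = x.1 * c.den := by exact_mod_cast hx2
    have hx4 : c * x.2 = x.1 := by
      rw [← hcq] at hx3
      apply mul_right_cancel₀ hqz.ne'
      linear_combination hx3
    have hden : ∀ y ∈ solPairs, y.2 ≠ 0 := by decide +kernel
    have hx5 : c = x.1 / x.2 := by
      rw [eq_div_iff (by exact_mod_cast hden x hx)]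
      exact hx4
    clear hx2 hx3 hx4 key hdc hcq hcop hcc hqz hne hden
    rw [hx5]
    simp only [solPairs, List.mem_cons, List.not_mem_nil, or_false] at hx
    simp only [Set.mem_insert_iff, Set.mem_singleton_iff]
    rcases hx with rfl | rfl | rfl | rfl | rfl | rfl | rfl | rfl | rfl | rfl | rfl | rfl | rfl | rfl | rfl | rfl | rfl | rfl | rfl | rfl | rfl | rfl | rfl | rfl | rfl | rfl | rfl | rfl | rfl | rfl | rfl | rfl | rfl | rfl | rfl | rfl | rfl <;> norm_num
  · intro h
    simp only [Set.mem_insert_iff, Set.mem_singleton_iff] at h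
    rcases h with rfl | rfl | rfl | rfl | rfl | rfl | rfl | rfl | rfl | rfl | rfl | rfl | rfl | rfl | rfl | rfl | rfl | rfl | rfl | rfl | rfl | rfl | rfl | rfl | rfl | rfl | rfl | rfl | rfl | rfl | rfl | rfl | rfl | rfl | rfl | rfl | rfl
    · exact ⟨by norm_num, 1, by norm_num, by norm_num⟩
    · exact ⟨by norm_num, 156, by norm_num, by norm_num⟩
    · exact ⟨by norm_num, 364, by norm_num, by norm_num⟩
    · exact ⟨by norm_num, 2296, by norm_num, by norm_num⟩
    · exact ⟨by norm_num, 6426, by norm_num, by norm_num⟩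
    · exact ⟨by norm_num, 10310, by norm_num, by norm_num⟩
    · exact ⟨by norm_num, 12339, by norm_num, by norm_num⟩
    · exact ⟨by norm_num, 19968, by norm_num, by norm_num⟩
    · exact ⟨by norm_num, 21414, by norm_num, by norm_num⟩
    · exact ⟨by norm_num, 28639, by norm_num, by norm_num⟩
    · exact ⟨by norm_num, 63428, by norm_num, by norm_num⟩
    · exact ⟨by norm_num, 96256, by norm_num, by norm_num⟩
    · exact ⟨by norm_num, 196884, by norm_num, by norm_num⟩
    · exact ⟨by norm_num, 390055, by norm_num, by norm_num⟩
    · exact ⟨by norm_num, 1107449, by norm_num, by norm_num⟩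
    · exact ⟨by norm_num, 2562886, by norm_num, by norm_num⟩
    · exact ⟨by norm_num, 9130564, by norm_num, by norm_num⟩
    · exact ⟨by norm_num, 1964871, by norm_num, by norm_num⟩
    · exact ⟨by norm_num, 572873, by norm_num, by norm_num⟩
    · exact ⟨by norm_num, 222130, by norm_num, by norm_num⟩
    · exact ⟨by norm_num, 207144, by norm_num, by norm_num⟩
    · exact ⟨by norm_num, 139504, by norm_num, by norm_num⟩
    · exact ⟨by norm_num, 90118, by norm_num, by norm_num⟩
    · exact ⟨by norm_num, 63366, by norm_num, by norm_num⟩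
    · exact ⟨by norm_num, 57889, by norm_num, by norm_num⟩
    · exact ⟨by norm_num, 49291, by norm_num, by norm_num⟩
    · exact ⟨by norm_num, 35856, by norm_num, by norm_num⟩
    · exact ⟨by norm_num, 20620, by norm_num, by norm_num⟩
    · exact ⟨by norm_num, 19098, by norm_num, by norm_num⟩
    · exact ⟨by norm_num, 14994, by norm_num, by norm_num⟩
    · exact ⟨by norm_num, 9919, by norm_num, by norm_num⟩
    · exact ⟨by norm_num, 8774, by norm_num, by norm_num⟩
    · exact ⟨by norm_num, 8146, by norm_num, by norm_num⟩
    · exact ⟨by norm_num, 8074, by norm_num, by norm_num⟩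
    · exact ⟨by norm_num, 7566, by norm_num, by norm_num⟩
    · exact ⟨by norm_num, 8154, by norm_num, by norm_num⟩
    · exact ⟨by norm_num, 54836, by norm_num, by norm_num⟩
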